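/- Let 𝒞 = {(x₁,x₂,x₃) ∈ ℝ³ : x₂² + x₃² ≤ 1} and let p : ℝ³ → [1,∞) be a measurable exponent with 3 < ess inf_{ℝ³∖𝒞} p ≤ ess sup_{ℝ³∖𝒞} p < 9/2 and 9/2 < ess inf_𝒞 p ≤ ess sup_𝒞 p < ∞. Let θ ∈ C_c^∞(ℝ³) with 0 ≤ θ ≤ 1, θ(x) = 1 for |x| ≤ 1 and θ(x) = 0 for |x| ≥ 2, and for R > 1 set θ_R(x) = θ(x/R). If u : ℝ³ → ℝ³ and P : ℝ³ → ℝ are measurable with u ∈ L^{p(·)}(ℝ³) and P ∈ L^{p(·)/2}(ℝ³), then ∫_{ℝ³} ∇θ_R(x) · ((|u(x)|²/2 + P(x)) u(x)) dx → 0 as R → ∞. -/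

import Mathlib

open MeasureTheory Filter Metric
open scoped ENNReal Topology NNReal

noncomputable section

/-- `ℝ³` as a Euclidean space (coordinates `x 0, x 1, x 2` standing for `x₁, x₂, x₃`). -/
abbrev E3 : Type := EuclideanSpace ℝ (Fin 3)

/-- Partial derivative `∂ᵢ g` of a scalar function on `ℝ³`. -/
def pd (i : Fin 3) (g : E3 → ℝ) (x : E3) : ℝ :=
  fderiv ℝ g x (EuclideanSpace.single i 1)

/-- Laplacian of a scalar function on `ℝ³`. -/
def lap3 (g : E3 → ℝ) (x : E3) : ℝ := ∑ i : Fin 3, pd i (pd i g) x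

/-- The modular `ρ_{p(·)}(f) = ∫ |f|^{p(x)} dx` for a finite real-valued variable exponent. -/
def modularV (p : E3 → ℝ) (f : E3 → ℝ) : ℝ≥0∞ :=
  ∫⁻ x, ENNReal.ofReal (|f x| ^ p x)

/-- Membership in the variable exponent Lebesgue space `L^{p(·)}(ℝ³)`
(finiteness of the Luxemburg norm). -/
def MemVarLp (p : E3 → ℝ) (f : E3 → ℝ) : Prop :=
  ∃ l : ℝ, 0 < l ∧ modularV p (fun x => f x / l) ≤ 1

/-- The Luxemburg norm `‖f‖_{L^{p(·)}(ℝ³)}`. -/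
def varLpNorm (p : E3 → ℝ) (f : E3 → ℝ) : ℝ :=
  sInf {l : ℝ | 0 < l ∧ modularV p (fun x => f x / l) ≤ 1}

/-- `(u, P)` is a weak solution of the stationary Navier–Stokes equations
`Δu − (u·∇)u − ∇P = 0`, `div u = 0` on `ℝ³`. -/
def IsWeakSolutionNS (u : E3 → E3) (P : E3 → ℝ) : Prop :=
  (∀ φ : E3 → E3, ContDiff ℝ (⊤ : ℕ∞) φ → HasCompactSupport φ →
      ((∫ x, ∑ j : Fin 3, u x j * lap3 (fun y => φ y j) x) +
        (∑ i : Fin 3, ∑ j : Fin 3, ∫ x, u x i * u x j * pd i (fun y => φ y j) x) +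
        (∫ x, P x * ∑ j : Fin 3, pd j (fun y => φ y j) x) = 0)) ∧
  (∀ ψ : E3 → ℝ, ContDiff ℝ (⊤ : ℕ∞) ψ → HasCompactSupport ψ →
      (∫ x, ∑ j : Fin 3, u x j * pd j ψ x) = 0)

/-- The infinite cylinder `𝒞 = {x ∈ ℝ³ : x₂² + x₃² ≤ 1}`. -/
def cylC : Set E3 := {x | (x 1) ^ 2 + (x 2) ^ 2 ≤ 1}


lemma aux_pointwise {w p M R : ℝ} (hw : 0 ≤ w) (hp : 3 < p) (hpM : p ≤ M) (hR : 1 ≤ R) :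
    R⁻¹ * w ^ 3 ≤ w ^ p + R ^ (-(1 + 3 / (M - 3))) := by
  have hR0 : 0 < R := by linarith
  have hRk : 0 ≤ R ^ (-(1 + 3 / (M - 3))) := by positivity
  by_cases h : R⁻¹ ≤ w ^ (p - 3)
  · have h1 : w ^ p = w ^ (p - 3) * w ^ 3 := by
      rw [← Real.rpow_natCast w 3, ← Real.rpow_add' hw (by norm_num; linarith)]
      norm_num
    have : R⁻¹ * w ^ 3 ≤ w ^ (p - 3) * w ^ 3 := by gcongr
    linarith
  · push Not at h
    have h1 : w ≤ R ^ (-(1 / (p - 3))) := by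
      have e : w = (w ^ (p - 3)) ^ (1 / (p - 3)) := by
        rw [← Real.rpow_mul hw, mul_one_div_cancel (by linarith), Real.rpow_one]
      rw [e, Real.rpow_neg hR0.le, ← Real.inv_rpow hR0.le]
      apply Real.rpow_le_rpow (by positivity) h.le
      exact div_nonneg zero_le_one (by linarith)
    have h2 : R⁻¹ * w ^ 3 ≤ R ^ (-(1 + 3 / (p - 3))) := by
      calc R⁻¹ * w ^ 3 ≤ R⁻¹ * (R ^ (-(1 / (p - 3)))) ^ 3 := by gcongr
        _ = R ^ (-(1 + 3 / (p - 3))) := by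
          rw [← Real.rpow_natCast _ 3, ← Real.rpow_mul hR0.le, ← Real.rpow_neg_one R,
            ← Real.rpow_add hR0]
          congr 1
          push_cast
          ring
    have h3 : R ^ (-(1 + 3 / (p - 3))) ≤ R ^ (-(1 + 3 / (M - 3))) := by
      apply Real.rpow_le_rpow_of_exponent_le hR
      have : 3 / (M - 3) ≤ 3 / (p - 3) :=
        div_le_div_of_nonneg_left (by norm_num) (by linarith) (by linarith)
      linarith
    have : 0 ≤ w ^ p := by positivity
    linarith

/-- The annulus. -/
def annul (R : ℝ) : Set E3 := {x | R ≤ ‖x‖ ∧ ‖x‖ ≤ 2 * R}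

lemma measurableSet_annul (R : ℝ) : MeasurableSet (annul R) :=
  (measurableSet_le measurable_const measurable_norm).inter
    (measurableSet_le measurable_norm measurable_const)

lemma aux_tail (f : E3 → ℝ≥0∞) (hf : Measurable f) (hfin : ∫⁻ x, f x ≠ ∞) :
    Tendsto (fun R : ℝ => ∫⁻ x in annul R, f x) atTop (𝓝 0) := by
  have h := tendsto_lintegral_filter_of_dominated_convergence (μ := (volume : Measure E3))
    (l := (atTop : Filter ℝ))
    (F := fun R => (annul R).indicator f) (f := fun _ => 0) f
    (Eventually.of_forall fun R => hf.indicator (measurableSet_annul R))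
    (Eventually.of_forall fun R => Eventually.of_forall fun x => Set.indicator_le_self _ _ x)
    hfin
    (Eventually.of_forall fun x => by
      apply tendsto_const_nhds.congr'
      filter_upwards [eventually_gt_atTop ‖x‖] with R hR
      rw [Set.indicator_of_notMem]
      intro hx
      exact absurd hx.1 (not_le.mpr hR))
  simp only [lintegral_zero] at h
  refine h.congr fun R => ?_
  rw [lintegral_indicator (measurableSet_annul R)]

lemma aux_piece (S : Set E3) (hS : MeasurableSet S) (p w : E3 → ℝ) (hp : Measurable p)
    (hw : Measurable w) (hw0 : ∀ x, 0 ≤ w x) (M c d : ℝ)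
    (hc : 0 ≤ c) (hd : d < 1 + 3 / (M - 3))
    (hlb : ∀ᵐ x ∂(volume.restrict S), 3 < p x) (hub : ∀ᵐ x ∂(volume.restrict S), p x ≤ M)
    (hvol : ∀ R : ℝ, 1 ≤ R → volume (S ∩ annul R) ≤ ENNReal.ofReal (c * R ^ d))
    (hfin : ∫⁻ x, ENNReal.ofReal (w x ^ p x) ≠ ∞) :
    Tendsto (fun R : ℝ => ∫⁻ x in S ∩ annul R, ENNReal.ofReal (R⁻¹ * w x ^ 3))
      atTop (𝓝 0) := by
  have h1 := aux_tail (fun x => ENNReal.ofReal (w x ^ p x)) (by fun_prop) hfin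
  have h2 : Tendsto (fun R : ℝ => ENNReal.ofReal (c * R ^ (-(1 + 3 / (M - 3) - d))))
      atTop (𝓝 0) := by
    have := (tendsto_rpow_neg_atTop (y := 1 + 3 / (M - 3) - d) (by linarith)).const_mul c
    simpa using ENNReal.tendsto_ofReal this
  have h3 := h1.add h2
  rw [add_zero] at h3
  refine tendsto_of_tendsto_of_tendsto_of_le_of_le' tendsto_const_nhds h3
    (Eventually.of_forall fun _ => zero_le) ?_
  filter_upwards [eventually_ge_atTop 1] with R hR
  have hR0 : 0 < R := by linarith
  have hsub : volume.restrict (S ∩ annul R) ≤ (volume.restrict S : Measure E3) :=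
    Measure.restrict_mono Set.inter_subset_left le_rfl
  calc ∫⁻ x in S ∩ annul R, ENNReal.ofReal (R⁻¹ * w x ^ 3)
      ≤ ∫⁻ x in S ∩ annul R, (ENNReal.ofReal (w x ^ p x)
          + ENNReal.ofReal (R ^ (-(1 + 3 / (M - 3))))) := by
        apply lintegral_mono_ae
        filter_upwards [ae_mono hsub hlb, ae_mono hsub hub] with x hx1 hx2
        rw [← ENNReal.ofReal_add (Real.rpow_nonneg (hw0 x) _) (by positivity)]
        exact ENNReal.ofReal_le_ofReal (aux_pointwise (hw0 x) hx1 hx2 hR)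
    _ = (∫⁻ x in S ∩ annul R, ENNReal.ofReal (w x ^ p x))
          + ENNReal.ofReal (R ^ (-(1 + 3 / (M - 3)))) * volume (S ∩ annul R) := by
        rw [lintegral_add_right _ measurable_const, setLIntegral_const]
    _ ≤ _ := by
        apply add_le_add
        · exact lintegral_mono_set Set.inter_subset_right
        · calc _ ≤ ENNReal.ofReal (R ^ (-(1 + 3 / (M - 3)))) * ENNReal.ofReal (c * R ^ d) := by
                gcongr
                exact hvol R hR
            _ = _ := by
                rw [← ENNReal.ofReal_mul (by positivity)]
                congr 1
                rw [mul_left_comm, ← Real.rpow_add hR0]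
                congr 2
                ring

lemma aux_box (a b c : ℝ) (ha : 0 ≤ a) (hb : 0 ≤ b) (hc : 0 ≤ c) :
    volume {x : E3 | |x 0| ≤ a ∧ |x 1| ≤ b ∧ |x 2| ≤ c} = ENNReal.ofReal (8 * a * b * c) := by
  have h := (PiLp.volume_preserving_ofLp (Fin 3)).measure_preimage
    (s := Set.univ.pi fun i : Fin 3 => Set.Icc (-(![a, b, c] i)) (![a, b, c] i))
    (MeasurableSet.univ_pi fun i => measurableSet_Icc).nullMeasurableSet
  have e : {x : E3 | |x 0| ≤ a ∧ |x 1| ≤ b ∧ |x 2| ≤ c} = (WithLp.ofLp : E3 → (Fin 3 → ℝ)) ⁻¹'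
      (Set.univ.pi fun i : Fin 3 => Set.Icc (-(![a, b, c] i)) (![a, b, c] i)) := by
    ext x
    simp only [Set.mem_setOf_eq, Set.mem_preimage, Set.mem_pi, Set.mem_univ, forall_const,
      Fin.forall_fin_succ, Set.mem_Icc, abs_le]
    simp
  rw [e, h, volume_pi_pi]
  simp only [Real.volume_Icc, Fin.prod_univ_three]
  rw [← ENNReal.ofReal_mul (by simp; linarith), ← ENNReal.ofReal_mul (by simp; positivity)]
  congr 1
  simp
  ring

lemma aux_coord (x : E3) (i : Fin 3) : |x i| ≤ ‖x‖ := by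
  simpa using PiLp.norm_apply_le x i

lemma measurableSet_cylC : MeasurableSet cylC :=
  measurableSet_le (by fun_prop) measurable_const

lemma aux_vol_in (R : ℝ) (hR : 1 ≤ R) :
    volume (cylC ∩ annul R) ≤ ENNReal.ofReal (16 * R ^ (1 : ℝ)) := by
  calc _ ≤ volume {x : E3 | |x 0| ≤ 2 * R ∧ |x 1| ≤ 1 ∧ |x 2| ≤ 1} := by
        apply measure_mono
        rintro x ⟨hx, hx2⟩
        have hx' : (x 1) ^ 2 + (x 2) ^ 2 ≤ 1 := hx
        refine ⟨(aux_coord x 0).trans hx2.2, ?_, ?_⟩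
        · apply abs_le_one_iff_mul_self_le_one.2; nlinarith [sq_nonneg (x 2)]
        · apply abs_le_one_iff_mul_self_le_one.2; nlinarith [sq_nonneg (x 1)]
    _ = _ := by
        rw [aux_box _ _ _ (by linarith) (by norm_num) (by norm_num), Real.rpow_one]
        congr 1
        ring

lemma aux_vol_out (R : ℝ) (hR : 1 ≤ R) :
    volume (cylCᶜ ∩ annul R) ≤ ENNReal.ofReal (64 * R ^ (3 : ℝ)) := by
  calc _ ≤ volume {x : E3 | |x 0| ≤ 2 * R ∧ |x 1| ≤ 2 * R ∧ |x 2| ≤ 2 * R} := by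
        apply measure_mono
        rintro x ⟨-, hx2⟩
        exact ⟨(aux_coord x 0).trans hx2.2, (aux_coord x 1).trans hx2.2,
          (aux_coord x 2).trans hx2.2⟩
    _ = _ := by
        rw [aux_box _ _ _ (by linarith) (by linarith) (by linarith)]
        congr 1
        norm_cast
        ring

lemma aux_essInf {μ : Measure E3} {p : E3 → ℝ} {a : ℝ} (ha : 0 ≤ a) (h : a < essInf p μ) :
    ∀ᵐ x ∂μ, a < p x := by
  rw [essInf, liminf_eq] at h
  have hne : {b | ∀ᵐ x ∂μ, b ≤ p x}.Nonempty := by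
    by_contra hn
    rw [Set.not_nonempty_iff_eq_empty] at hn
    rw [hn, Real.sSup_empty] at h
    linarith
  obtain ⟨b, hb, hab⟩ := exists_lt_of_lt_csSup hne h
  filter_upwards [hb] with x hx
  linarith

lemma aux_essSup {μ : Measure E3} {p : E3 → ℝ} {a : ℝ} (h0 : 0 < essSup p μ)
    (h : essSup p μ < a) : ∃ b < a, ∀ᵐ x ∂μ, p x ≤ b := by
  rw [essSup, limsup_eq] at h h0
  have hne : {b | ∀ᵐ x ∂μ, p x ≤ b}.Nonempty := by
    by_contra hn
    rw [Set.not_nonempty_iff_eq_empty] at hn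
    rw [hn, Real.sInf_empty] at h0
    linarith
  obtain ⟨b, hb, hab⟩ := exists_lt_of_csInf_lt hne h
  exact ⟨b, hab, hb⟩

lemma aux_main (p : E3 → ℝ) (hpmeas : Measurable p)
    (hout_lb : (3 : ℝ) < essInf p (volume.restrict cylCᶜ))
    (hout_le : essInf p (volume.restrict cylCᶜ) ≤ essSup p (volume.restrict cylCᶜ))
    (hout_ub : essSup p (volume.restrict cylCᶜ) < 9 / 2)
    (hin_lb : (9 / 2 : ℝ) < essInf p (volume.restrict cylC))
    (hin_ub : IsBoundedUnder (· ≤ ·) (ae (volume.restrict cylC)) p)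
    (w : E3 → ℝ) (hw : Measurable w) (hw0 : ∀ x, 0 ≤ w x)
    (hfin : ∫⁻ x, ENNReal.ofReal (w x ^ p x) ≠ ∞) :
    Tendsto (fun R : ℝ => ∫⁻ x in annul R, ENNReal.ofReal (R⁻¹ * w x ^ 3))
      atTop (𝓝 0) := by
  obtain ⟨b, hb, hpb⟩ := aux_essSup (by linarith) hout_ub
  obtain ⟨m, hm⟩ := hin_ub
  rw [eventually_map] at hm
  have t1 := aux_piece cylC measurableSet_cylC p w hpmeas hw hw0 (max m 4) 16 1 (by norm_num)
    (by
      have : (4 : ℝ) ≤ max m 4 := le_max_right _ _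
      have : 0 < 3 / (max m 4 - 3) := div_pos (by norm_num) (by linarith)
      linarith)
    (by filter_upwards [aux_essInf (by norm_num) hin_lb] with x hx; linarith)
    (by filter_upwards [hm] with x hx; exact le_max_of_le_left hx) aux_vol_in hfin
  have t2 := aux_piece cylCᶜ measurableSet_cylC.compl p w hpmeas hw hw0 (max b 4) 64 3
    (by norm_num)
    (by
      have h4 : (4 : ℝ) ≤ max b 4 := le_max_right _ _
      have h5 : max b 4 < 9 / 2 := max_lt hb (by norm_num)
      have : 2 < 3 / (max b 4 - 3) := by
        rw [lt_div_iff₀ (by linarith)]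
        linarith
      linarith)
    (aux_essInf (by norm_num) hout_lb)
    (by filter_upwards [hpb] with x hx; exact le_max_of_le_left hx) aux_vol_out hfin
  have t := t1.add t2
  rw [add_zero] at t
  refine t.congr fun R => ?_
  rw [← lintegral_inter_add_diff (μ := volume) _ (annul R) measurableSet_cylC,
    Set.inter_comm cylC, Set.inter_comm cylCᶜ, Set.sdiff_eq]

/-- The term `β(R) = ∫ ∇θ_R · ((|u|²/2 + P) u) dx` tends to `0` as `R → ∞` when
`u ∈ L^{p(·)}(ℝ³)` and `P ∈ L^{p(·)/2}(ℝ³)` for the cylinder-adapted exponent `p`. -/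
theorem beta_term_tendsto_zero
    (p : E3 → ℝ) (hpmeas : Measurable p) (hp1 : ∀ x, 1 ≤ p x)
    (hout_lb : (3 : ℝ) < essInf p (volume.restrict cylCᶜ))
    (hout_le : essInf p (volume.restrict cylCᶜ) ≤ essSup p (volume.restrict cylCᶜ))
    (hout_ub : essSup p (volume.restrict cylCᶜ) < 9 / 2)
    (hin_lb : (9 / 2 : ℝ) < essInf p (volume.restrict cylC))
    (hin_le : essInf p (volume.restrict cylC) ≤ essSup p (volume.restrict cylC))
    (hin_ub : IsBoundedUnder (· ≤ ·) (ae (volume.restrict cylC)) p)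
    (θ : E3 → ℝ) (hθsmooth : ContDiff ℝ (⊤ : ℕ∞) θ) (hθsupp : HasCompactSupport θ)
    (hθ0 : ∀ x, 0 ≤ θ x) (hθ1 : ∀ x, θ x ≤ 1)
    (hθin : ∀ x : E3, ‖x‖ ≤ 1 → θ x = 1) (hθout : ∀ x : E3, 2 ≤ ‖x‖ → θ x = 0)
    (u : E3 → E3) (P : E3 → ℝ) (hu_meas : Measurable u) (hP_meas : Measurable P)
    (hu_p : MemVarLp p (fun x => ‖u x‖))
    (hP_p : MemVarLp (fun x => p x / 2) P) :
    Tendsto (fun R : ℝ => ∫ x, ∑ i : Fin 3,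
        pd i (fun y => θ (R⁻¹ • y)) x * ((‖u x‖ ^ 2 / 2 + P x) * u x i))
      atTop (𝓝 0) := by

  obtain ⟨l, hl, hul⟩ := hu_p
  obtain ⟨m, hm, hPm⟩ := hP_p
  set v : E3 → ℝ := fun x => ‖u x‖ / l with hv
  set q : E3 → ℝ := fun x => |P x / m| ^ (1 / 2 : ℝ) with hq
  have hv0 : ∀ x, 0 ≤ v x := fun x => by positivity
  have hq0 : ∀ x, 0 ≤ q x := fun x => by positivity
  have hvm : Measurable v := by fun_prop
  have hqm : Measurable q := by
    have : Measurable fun x => |P x / m| := (hP_meas.div_const m).abs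
    fun_prop
  have tv := aux_main p hpmeas hout_lb hout_le hout_ub hin_lb hin_ub v hvm hv0 (by
    refine ne_top_of_le_ne_top ENNReal.one_ne_top (le_trans (le_of_eq ?_) hul)
    unfold modularV
    refine lintegral_congr fun x => ?_
    rw [abs_of_nonneg (hv0 x)])
  have tq := aux_main p hpmeas hout_lb hout_le hout_ub hin_lb hin_ub q hqm hq0 (by
    refine ne_top_of_le_ne_top ENNReal.one_ne_top (le_trans (le_of_eq ?_) hPm)
    unfold modularV
    refine lintegral_congr fun x => ?_
    simp only [hq]
    rw [← Real.rpow_mul (abs_nonneg _)]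
    congr 2
    ring)
  obtain ⟨K, hK⟩ := (hθsmooth.continuous_fderiv (by simp)).bounded_above_of_compact_support
    (hθsupp.fderiv (𝕜 := ℝ))
  have hK0 : 0 ≤ K := (norm_nonneg _).trans (hK 0)
  set D : ℝ := 3 * K * (l ^ 3 + m * l) with hD
  have hD0 : 0 ≤ D := by positivity
  have hpd : ∀ R : ℝ, 1 ≤ R → ∀ (x : E3) (i : Fin 3),
      |pd i (fun y => θ (R⁻¹ • y)) x| ≤ R⁻¹ * K ∧
      (x ∉ annul R → pd i (fun y => θ (R⁻¹ • y)) x = 0) := by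
    intro R hR x i
    have hR0 : 0 < R := by linarith
    have e : pd i (fun y => θ (R⁻¹ • y)) x
        = R⁻¹ * fderiv ℝ θ (R⁻¹ • x) (EuclideanSpace.single i 1) := by
      unfold pd
      rw [fderiv_comp_smul]
      simp
    have hn : ‖R⁻¹ • x‖ = ‖x‖ / R := by
      rw [norm_smul, Real.norm_of_nonneg (by positivity)]
      field_simp
    constructor
    · rw [e, abs_mul, abs_of_pos (inv_pos.2 hR0)]
      gcongr
      have := (fderiv ℝ θ (R⁻¹ • x)).le_opNorm (EuclideanSpace.single i 1)
      simp only [EuclideanSpace.norm_single, norm_one, mul_one, Real.norm_eq_abs] at this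
      exact this.trans (hK _)
    · intro hx
      have hz : fderiv ℝ θ (R⁻¹ • x) = 0 := by
        by_cases h1 : ‖x‖ < R
        · apply IsLocalMax.fderiv_eq_zero
          refine Eventually.of_forall fun y => ?_
          rw [hθin (R⁻¹ • x) (by rw [hn, div_le_one hR0]; exact h1.le)]
          exact hθ1 y
        · have h2 : 2 * R < ‖x‖ := by
            by_contra h3
            exact hx ⟨not_lt.1 h1, not_lt.1 h3⟩
          apply IsLocalMin.fderiv_eq_zero
          refine Eventually.of_forall fun y => ?_
          rw [hθout (R⁻¹ • x) (by rw [hn, le_div_iff₀ hR0]; exact h2.le)]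
          exact hθ0 y
      rw [e, hz]
      simp
  have hpt : ∀ x, (‖u x‖ ^ 2 / 2 + |P x|) * ‖u x‖ ≤ (l ^ 3 + m * l) * (v x ^ 3 + q x ^ 3) := by
    intro x
    have hu : ‖u x‖ = l * v x := by simp only [hv]; field_simp
    have hP : |P x| = m * q x ^ 2 := by
      simp only [hq]
      rw [← Real.rpow_natCast, ← Real.rpow_mul (abs_nonneg _), abs_div, abs_of_pos hm]
      norm_num
      field_simp
    have hy : q x ^ 2 * v x ≤ v x ^ 3 + q x ^ 3 := by
      rcases le_total (v x) (q x) with h | h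
      · have : q x ^ 2 * v x ≤ q x ^ 2 * q x := by gcongr
        have := pow_nonneg (hv0 x) 3
        nlinarith
      · have : q x ^ 2 * v x ≤ v x ^ 2 * v x := by
          have := hq0 x
          have := hv0 x
          gcongr
        have := pow_nonneg (hq0 x) 3
        nlinarith
    rw [hu, hP]
    have h3 := pow_nonneg (hv0 x) 3
    have h4 := pow_nonneg (hq0 x) 3
    calc ((l * v x) ^ 2 / 2 + m * q x ^ 2) * (l * v x)
        = l ^ 3 * (v x ^ 3 / 2) + m * l * (q x ^ 2 * v x) := by ring
      _ ≤ l ^ 3 * (v x ^ 3 + q x ^ 3) + m * l * (v x ^ 3 + q x ^ 3) := by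
          gcongr
          linarith
      _ = _ := by ring
  have ht := ENNReal.Tendsto.const_mul (a := ENNReal.ofReal D) (tv.add tq)
    (Or.inr ENNReal.ofReal_ne_top)
  simp only [add_zero, mul_zero] at ht
  rw [tendsto_zero_iff_enorm_tendsto_zero]
  refine tendsto_of_tendsto_of_tendsto_of_le_of_le' tendsto_const_nhds ht
    (Eventually.of_forall fun _ => zero_le) ?_
  filter_upwards [eventually_ge_atTop 1] with R hR
  have hR0 : 0 < R := by linarith
  refine (enorm_integral_le_lintegral_enorm _).trans ?_
  rw [← lintegral_add_left (by fun_prop), ← lintegral_const_mul _ (by fun_prop),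
    ← lintegral_indicator (measurableSet_annul R)]
  refine lintegral_mono fun x => ?_
  by_cases hx : x ∈ annul R
  · rw [Set.indicator_of_mem hx, Real.enorm_eq_ofReal_abs,
      ← ENNReal.ofReal_add (by have := hv0 x; positivity) (by have := hq0 x; positivity),
      ← ENNReal.ofReal_mul hD0]
    apply ENNReal.ofReal_le_ofReal
    calc |∑ i : Fin 3, pd i (fun y => θ (R⁻¹ • y)) x * ((‖u x‖ ^ 2 / 2 + P x) * u x i)|
        ≤ ∑ i : Fin 3, |pd i (fun y => θ (R⁻¹ • y)) x * ((‖u x‖ ^ 2 / 2 + P x) * u x i)| :=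
          Finset.abs_sum_le_sum_abs _ _
      _ ≤ ∑ i : Fin 3, (R⁻¹ * K) * ((l ^ 3 + m * l) * (v x ^ 3 + q x ^ 3)) := by
          apply Finset.sum_le_sum
          intro i _
          rw [abs_mul, abs_mul]
          refine mul_le_mul (hpd R hR x i).1 (le_trans ?_ (hpt x)) (by positivity) (by positivity)
          refine mul_le_mul ?_ (aux_coord _ i) (abs_nonneg _) (by positivity)
          refine (abs_add_le _ _).trans ?_
          rw [abs_of_nonneg (by positivity : 0 ≤ ‖u x‖ ^ 2 / 2)]
      _ = _ := by
          simp only [Finset.sum_const, Finset.card_univ, Fintype.card_fin, hD]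
          ring
  · rw [Set.indicator_of_notMem hx]
    simp [fun i => (hpd R hR x i).2 hx]
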